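/- The sequence 0 → ℂ*/μ* → ℂ ∧_ℤ ℂ → ℂ* ∧_ℤ ℂ* → 0 is exact, where μ* is the group of roots of unity in ℂ*, the first map β is induced by z ↦ (Log z) ∧ πi (this is well defined, independent of the branch of logarithm and trivial on μ*), and the second map ε is the homomorphism determined by w₁ ∧ w₂ ↦ -2(e^{w₁} ∧ e^{w₂}). -/

import Mathlib

open Complex
open scoped Classical

noncomputable section

namespace ExtendedBloch

/-- `π` as a complex number. -/
def Cpi : ℂ := (Real.pi : ℂ)

/-- Membership in `ℂ ∖ {0,1}`. -/
def Reg (z : ℂ) : Prop := z ≠ 0 ∧ z ≠ 1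

/-- The open upper half plane. -/
def UHP : Set ℂ := {z : ℂ | 0 < z.im}

/-- The 5-tuple occurring in the five term relation. -/
def ftTuple (x y : ℂ) : Fin 5 → ℂ :=
  ![x, y, y / x, (1 - x⁻¹) / (1 - y⁻¹), (1 - x) / (1 - y)]

/-- The set `FT` of five term tuples. -/
def FT : Set (Fin 5 → ℂ) :=
  {v | ∃ x y : ℂ, Reg x ∧ Reg y ∧ x ≠ y ∧ v = ftTuple x y}

/-- The subset `FT⁺` of tuples with all coordinates in the upper half plane. -/
def FTplus : Set (Fin 5 → ℂ) := {v | v ∈ FT ∧ ∀ i, v i ∈ UHP}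

/-- The point `(z; p, q)` of the cover `𝓒` of `ℂ ∖ {0,1}`, realized concretely as the pair of
branch values `(log z + pπi, -log(1-z) + qπi)` (Riemann surface model of `𝓒`). -/
def pt (z : ℂ) (p q : ℤ) : ℂ × ℂ :=
  (Complex.log z + p * (Cpi * I), -Complex.log (1 - z) + q * (Cpi * I))

/-- The cover `𝓒`, realized as the Riemann surface of all branches of
`(log z + pπi, -log(1-z) + qπi)` on `ℂ ∖ {0,1}`. -/
def Cover : Set (ℂ × ℂ) := {w | ∃ z : ℂ, Reg z ∧ ∃ p q : ℤ, w = pt z p q}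

lemma pt_mem_Cover {z : ℂ} (h : Reg z) (p q : ℤ) : pt z p q ∈ Cover :=
  ⟨z, h, p, q, rfl⟩

/-- `w ∈ 𝓒` lies over `z ∈ ℂ ∖ {0,1}`. -/
def LiesOver (w : ℂ × ℂ) (z : ℂ) : Prop := Reg z ∧ ∃ p q : ℤ, w = pt z p q

/-- The covering action of `ℤ × ℤ` on `𝓒`. -/
def covAct (v : ℤ × ℤ) (w : ℂ × ℂ) : ℂ × ℂ :=
  (w.1 + v.1 * (Cpi * I), w.2 + v.2 * (Cpi * I))

/-- The subset `V ⊂ (ℤ × ℤ)⁵`. -/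
def Vset : Set (Fin 5 → ℤ × ℤ) :=
  {v | ∃ p₀ p₁ q₀ q₁ q₂ : ℤ,
    v = ![(p₀, q₀), (p₁, q₁), (p₁ - p₀, q₂), (p₁ - p₀ + q₁ - q₀, q₂ - q₁),
          (q₁ - q₀, q₂ - q₁ - p₀)]}

/-- The preimage of `FT` in `𝓒⁵`. -/
def FTpre : Set (Fin 5 → ℂ × ℂ) := {w | ∃ v ∈ FT, ∀ i, LiesOver (w i) (v i)}

/-- A base point `((x₀;0,0),…,(x₄;0,0))` with `(x₀,…,x₄) ∈ FT⁺`. -/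
def basePt : Fin 5 → ℂ × ℂ := fun i => pt (ftTuple ((1 + I) / 4) I i) 0 0

/-- `𝓕𝓣̂₀`: the connected component of the preimage of `FT` in `𝓒⁵` containing the points
`((x₀;0,0),…,(x₄;0,0))` with `(x₀,…,x₄) ∈ FT⁺`. -/
def FThat₀ : Set (Fin 5 → ℂ × ℂ) := connectedComponentIn FTpre basePt

/-- `𝓕𝓣̂ = 𝓕𝓣̂₀ + V`. -/
def FThat : Set (Fin 5 → ℂ × ℂ) :=
  {u | ∃ w ∈ FThat₀, ∃ v ∈ Vset, u = fun i => covAct (v i) (w i)}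

abbrev CoverT : Type := ↥Cover

/-- The generator `(z; p, q)` of the free abelian group on `𝓒`. -/
def genOf (z : ℂ) (h : Reg z) (p q : ℤ) : FreeAbelianGroup CoverT :=
  FreeAbelianGroup.of ⟨pt z p q, pt_mem_Cover h p q⟩

/-- The lifted five term relators. -/
def FiveTermRels : Set (FreeAbelianGroup CoverT) :=
  {a | ∃ w : Fin 5 → ℂ × ℂ, w ∈ FThat ∧ ∃ hc : ∀ i, w i ∈ Cover,
    a = ∑ i : Fin 5, (-1 : ℤ) ^ (i : ℕ) • FreeAbelianGroup.of (⟨w i, hc i⟩ : CoverT)}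

/-- The transfer relators. -/
def TransferRels : Set (FreeAbelianGroup CoverT) :=
  {a | ∃ z : ℂ, ∃ h : Reg z, ∃ p q p' q' : ℤ,
    a = genOf z h p q + genOf z h p' q' - genOf z h p q' - genOf z h p' q}

def relSub : AddSubgroup (FreeAbelianGroup CoverT) :=
  AddSubgroup.closure (FiveTermRels ∪ TransferRels)

def relSub' : AddSubgroup (FreeAbelianGroup CoverT) :=
  AddSubgroup.closure FiveTermRels

/-- The extended pre-Bloch group `êP(ℂ)`. -/
abbrev EPreBloch : Type := FreeAbelianGroup CoverT ⧸ relSub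

/-- The variant `êP'(ℂ)` without the transfer relations. -/
abbrev EPreBloch' : Type := FreeAbelianGroup CoverT ⧸ relSub'

/-- The class `[z, p, q] ∈ êP(ℂ)` (junk value `0` if `z ∈ {0,1}`). -/
def cls (z : ℂ) (p q : ℤ) : EPreBloch :=
  if h : Reg z then QuotientAddGroup.mk (genOf z h p q) else 0

/-- The class `[z, p, q] ∈ êP'(ℂ)` (junk value `0` if `z ∈ {0,1}`). -/
def cls' (z : ℂ) (p q : ℤ) : EPreBloch' :=
  if h : Reg z then QuotientAddGroup.mk (genOf z h p q) else 0

/-- `ℂ ∧_ℤ ℂ`, the second exterior power of `ℂ` as a `ℤ`-module. -/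
abbrev L2C : Type := ↥(⋀[ℤ]^2 ℂ)

/-- The wedge `a ∧ b ∈ ℂ ∧_ℤ ℂ`. -/
def wedge (a b : ℂ) : L2C :=
  ⟨ExteriorAlgebra.ιMulti ℤ 2 ![a, b],
   ExteriorAlgebra.ιMulti_range ℤ 2 (Set.mem_range_self _)⟩

def nuFree : FreeAbelianGroup CoverT →+ L2C :=
  FreeAbelianGroup.lift fun w : CoverT => wedge w.1.1 w.1.2

/-- The homomorphism `ν : êP(ℂ) → ℂ ∧_ℤ ℂ`. -/
def nuHom : EPreBloch →+ L2C :=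
  if h : ∀ a ∈ relSub, nuFree a = 0 then QuotientAddGroup.lift relSub nuFree h else 0

/-- The homomorphism `ν : êP'(ℂ) → ℂ ∧_ℤ ℂ`. -/
def nuHom' : EPreBloch' →+ L2C :=
  if h : ∀ a ∈ relSub', nuFree a = 0 then QuotientAddGroup.lift relSub' nuFree h else 0

/-- The extended Bloch group `êB(ℂ) = ker ν`. -/
def EBloch : AddSubgroup EPreBloch := nuHom.ker

/-- `êB'(ℂ) = ker ν` on `êP'(ℂ)`. -/
def EBloch' : AddSubgroup EPreBloch' := nuHom'.ker

/-- The component `X₀₀` of `𝓒` (both fiber coordinates even). -/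
def X00 : Set (ℂ × ℂ) := {w | ∃ z : ℂ, Reg z ∧ ∃ p q : ℤ, w = pt z (2 * p) (2 * q)}

abbrev X00T : Type := ↥X00

lemma pt_mem_X00 {z : ℂ} (h : Reg z) (p q : ℤ) : pt z (2 * p) (2 * q) ∈ X00 :=
  ⟨z, h, p, q, rfl⟩

/-- The generator `(z; 2p, 2q)` of the free abelian group on `X₀₀`. -/
def genOf₀ (z : ℂ) (h : Reg z) (p q : ℤ) : FreeAbelianGroup X00T :=
  FreeAbelianGroup.of ⟨pt z (2 * p) (2 * q), pt_mem_X00 h p q⟩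

/-- The five term relators coming from `𝓕𝓣̂ ∩ (X₀₀)⁵`. -/
def FiveTermRels₀ : Set (FreeAbelianGroup X00T) :=
  {a | ∃ w : Fin 5 → ℂ × ℂ, w ∈ FThat ∧ ∃ hc : ∀ i, w i ∈ X00,
    a = ∑ i : Fin 5, (-1 : ℤ) ^ (i : ℕ) • FreeAbelianGroup.of (⟨w i, hc i⟩ : X00T)}

def relSub₀ : AddSubgroup (FreeAbelianGroup X00T) := AddSubgroup.closure FiveTermRels₀

/-- The true extended pre-Bloch group `êêP(ℂ)`. -/
abbrev EEPreBloch : Type := FreeAbelianGroup X00T ⧸ relSub₀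

/-- The class `[z, 2p, 2q] ∈ êêP(ℂ)` (junk value `0` if `z ∈ {0,1}`). -/
def cls₀ (z : ℂ) (p q : ℤ) : EEPreBloch :=
  if h : Reg z then QuotientAddGroup.mk (genOf₀ z h p q) else 0

def nuFree₀ : FreeAbelianGroup X00T →+ L2C :=
  FreeAbelianGroup.lift fun w : X00T => wedge w.1.1 w.1.2

/-- The homomorphism `ν̂ : êêP(ℂ) → ℂ ∧_ℤ ℂ`. -/
def nuHom₀ : EEPreBloch →+ L2C :=
  if h : ∀ a ∈ relSub₀, nuFree₀ a = 0 then QuotientAddGroup.lift relSub₀ nuFree₀ h else 0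

/-- The true extended Bloch group `êêB(ℂ) = ker ν̂`. -/
def EEBloch : AddSubgroup EEPreBloch := nuHom₀.ker

/-- The Rogers dilogarithm `𝓡(z) = ½ log z log(1-z) - ∫₀ᶻ log(1-t)/t dt` (straight segment,
parametrized by `t = s z`). -/
def rogers (z : ℂ) : ℂ :=
  (1 / 2) * Complex.log z * Complex.log (1 - z) -
    ∫ s in (0:ℝ)..(1:ℝ), Complex.log (1 - (s : ℂ) * z) / (s : ℂ)

/-- `R(z; p, q) = 𝓡(z) + (πi/2)(p log(1-z) + q log z) - π²/6`. -/
def Rfun (z : ℂ) (p q : ℤ) : ℂ :=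
  rogers z + (Cpi * I / 2) * (p * Complex.log (1 - z) + q * Complex.log z) - Cpi ^ 2 / 6

/-- `R̂(z; 2p, 2q) = 𝓡(z) + πi(p log(1-z) + q log z) - π²/6`. -/
def Rhat (z : ℂ) (p q : ℤ) : ℂ :=
  rogers z + Cpi * I * (p * Complex.log (1 - z) + q * Complex.log z) - Cpi ^ 2 / 6

/-- `ℂ / π²ℤ`. -/
abbrev ModPiSq : Type := ℂ ⧸ AddSubgroup.zmultiples (Cpi ^ 2)

/-- `ℂ / 2π²ℤ`. -/
abbrev Mod2PiSq : Type := ℂ ⧸ AddSubgroup.zmultiples (2 * Cpi ^ 2)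

abbrev RegT : Type := {z : ℂ // Reg z}

def pbGen (z : ℂ) (h : Reg z) : FreeAbelianGroup RegT := FreeAbelianGroup.of ⟨z, h⟩

/-- The five term relators for the classical pre-Bloch group. -/
def pbRels : Set (FreeAbelianGroup RegT) :=
  {a | ∃ x y : ℂ, ∃ hx : Reg x, ∃ hy : Reg y, x ≠ y ∧
    ∃ h2 : Reg (y / x), ∃ h3 : Reg ((1 - x⁻¹) / (1 - y⁻¹)), ∃ h4 : Reg ((1 - x) / (1 - y)),
    a = pbGen x hx - pbGen y hy + pbGen (y / x) h2 -
        pbGen ((1 - x⁻¹) / (1 - y⁻¹)) h3 + pbGen ((1 - x) / (1 - y)) h4}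

def pbSub : AddSubgroup (FreeAbelianGroup RegT) := AddSubgroup.closure pbRels

/-- The classical pre-Bloch group `P(ℂ)`. -/
abbrev PreBloch : Type := FreeAbelianGroup RegT ⧸ pbSub

/-- The class `[z] ∈ P(ℂ)` (junk value `0` if `z ∈ {0,1}`). -/
def pbCls (z : ℂ) : PreBloch :=
  if h : Reg z then QuotientAddGroup.mk (pbGen z h) else 0

/-- `ℂ* ∧_ℤ ℂ*`, the second exterior power of the multiplicative group `ℂ*` as `ℤ`-module. -/
abbrev L2CU : Type := ↥(⋀[ℤ]^2 (Additive ℂˣ))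

/-- The wedge `a ∧ b ∈ ℂ* ∧_ℤ ℂ*`. -/
def wedgeU (a b : ℂˣ) : L2CU :=
  ⟨ExteriorAlgebra.ιMulti ℤ 2 ![Additive.ofMul a, Additive.ofMul b],
   ExteriorAlgebra.ιMulti_range ℤ 2 (Set.mem_range_self _)⟩

def nuPBFree : FreeAbelianGroup RegT →+ L2CU :=
  FreeAbelianGroup.lift fun z : RegT =>
    2 • wedgeU (Units.mk0 z.1 z.2.1) (Units.mk0 (1 - z.1) (sub_ne_zero_of_ne (Ne.symm z.2.2)))

/-- The homomorphism `P(ℂ) → ℂ* ∧_ℤ ℂ*`, `[z] ↦ 2 (z ∧ (1-z))`. -/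
def nuPB : PreBloch →+ L2CU :=
  if h : ∀ a ∈ pbSub, nuPBFree a = 0 then QuotientAddGroup.lift pbSub nuPBFree h else 0

/-- The classical Bloch group `B(ℂ)`. -/
def Bloch : AddSubgroup PreBloch := nuPB.ker

/-- The roots of unity in `ℂ*`. -/
def muStar : Set ℂˣ := {ζ | ∃ n : ℕ, 0 < n ∧ ζ ^ n = 1}

abbrev SL2C := Matrix.SpecialLinearGroup (Fin 2) ℂ

/-- `PSL(2,ℂ) = SL(2,ℂ)/{±1}` as a discrete group. -/
abbrev PSL2C := SL2C ⧸ Subgroup.center SL2C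

/-- The boundary map `C₃ → C₂` of the inhomogeneous bar complex computing `H₃(PSL(2,ℂ);ℤ)`. -/
def d3 : FreeAbelianGroup (Fin 3 → PSL2C) →+ FreeAbelianGroup (Fin 2 → PSL2C) :=
  FreeAbelianGroup.lift fun g =>
    FreeAbelianGroup.of ![g 1, g 2] - FreeAbelianGroup.of ![g 0 * g 1, g 2] +
      FreeAbelianGroup.of ![g 0, g 1 * g 2] - FreeAbelianGroup.of ![g 0, g 1]

/-- The boundary map `C₄ → C₃` of the inhomogeneous bar complex computing `H₃(PSL(2,ℂ);ℤ)`. -/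
def d4 : FreeAbelianGroup (Fin 4 → PSL2C) →+ FreeAbelianGroup (Fin 3 → PSL2C) :=
  FreeAbelianGroup.lift fun g =>
    FreeAbelianGroup.of ![g 1, g 2, g 3] - FreeAbelianGroup.of ![g 0 * g 1, g 2, g 3] +
      FreeAbelianGroup.of ![g 0, g 1 * g 2, g 3] - FreeAbelianGroup.of ![g 0, g 1, g 2 * g 3] +
      FreeAbelianGroup.of ![g 0, g 1, g 2]

/-- `H₃(PSL(2,ℂ);ℤ)`, defined as homology of the inhomogeneous bar complex. -/
abbrev H3PSL2C : Type := ↥d3.ker ⧸ ((d4.range).addSubgroupOf d3.ker)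

/-- The set of combinatorial flattenings. -/
def Flattenings : Set (ℂ × ℂ × ℂ) :=
  {w | w.1 + w.2.1 + w.2.2 = 0 ∧ ∃ z : ℂ, Reg z ∧ ∃ p q r : ℤ,
    w.1 = Complex.log z + p * (Cpi * I) ∧
    w.2.1 = -Complex.log (1 - z) + q * (Cpi * I) ∧
    w.2.2 = Complex.log (1 - z) - Complex.log z + r * (Cpi * I)}

/-- The map `ℓ : 𝓒 → ℂ³`. -/
def ellMap (w : ℂ × ℂ) : ℂ × ℂ × ℂ := (w.1, w.2, -w.1 - w.2)

/-- The element `κ = [x,1,1] + [x,0,0] - [x,1,0] - [x,0,1] ∈ êP'(ℂ)`. -/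
def kap (x : ℂ) : EPreBloch' := cls' x 1 1 + cls' x 0 0 - cls' x 1 0 - cls' x 0 1

/-- The natural projection `êP'(ℂ) → êP(ℂ)`. -/
def projP : EPreBloch' →+ EPreBloch :=
  QuotientAddGroup.map relSub' relSub (AddMonoidHom.id _)
    (by
      rw [AddSubgroup.comap_id]
      exact AddSubgroup.closure_mono Set.subset_union_left)

section ExteriorSquare

variable {A N : Type*} [AddCommGroup A] [Module ℤ A] [AddCommGroup N]

/-- The biadditive map `(a, b) ↦ a ∧ b` into the exterior square of an abelian group. -/
def extSq (A : Type*) [AddCommGroup A] [Module ℤ A] : A →+ A →+ ⋀[ℤ]^2 A :=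
  AddMonoidHom.mk' (fun a => AddMonoidHom.mk' (fun b => exteriorPower.ιMulti ℤ 2 ![a, b])
    fun b b' => by
      have h (x : A) : Function.update ![a, 0] 1 x = ![a, x] := by
        ext i
        fin_cases i <;> rfl
      simpa only [h] using (exteriorPower.ιMulti ℤ 2 (M := A)).map_update_add ![a, 0] 1 b b')
    fun a a' => by
      ext1 b
      exact (exteriorPower.ιMulti ℤ 2 (M := A)).map_vecCons_add ![b] a a'

lemma extSq_apply (a b : A) : extSq A a b = exteriorPower.ιMulti ℤ 2 ![a, b] := rfl

lemma extSq_self (a : A) : extSq A a a = 0 :=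
  (exteriorPower.ιMulti ℤ 2).map_eq_zero_of_eq ![a, a] (i := 0) (j := 1) rfl (by decide)

lemma extSq_add_left (a a' b : A) : extSq A (a + a') b = extSq A a b + extSq A a' b := by
  rw [map_add, AddMonoidHom.add_apply]

lemma extSq_neg_left (a b : A) : extSq A (-a) b = -extSq A a b :=
  map_neg ((extSq A).flip b) a

lemma extSq_zsmul_left (n : ℤ) (a b : A) : extSq A (n • a) b = n • extSq A a b :=
  map_zsmul ((extSq A).flip b) n a

lemma extSq_swap (a b : A) :
    extSq A a b = -extSq A b a := by
  have h := extSq_self (a + b)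
  simp only [map_add, AddMonoidHom.add_apply, extSq_self, zero_add, add_zero] at h
  exact eq_neg_of_add_eq_zero_right h

/-- The homomorphism out of the exterior square induced by an alternating biadditive map. -/
def extSqLift (B : A →+ A →+ N) (hB : ∀ a, B a a = 0) : ⋀[ℤ]^2 A →+ N :=
  (exteriorPower.alternatingMapLinearEquiv (R := ℤ) (n := 2) (M := A)
    { toFun := fun v => B (v 0) (v 1)
      map_update_add' := by
        intro _ m i x y
        fin_cases i <;> simp
      map_update_smul' := by
        intro _ m i c x
        have hc := Int.cast_smul_eq_zsmul ℤ c x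
        rw [Int.cast_id] at hc
        rw [hc]
        fin_cases i <;> simp
      map_eq_zero_of_eq' := by
        intro v i j h hij
        have h01 : v 0 = v 1 := by fin_cases i <;> fin_cases j <;> simp_all
        rw [h01, hB] }).toAddMonoidHom

lemma extSqLift_extSq (B : A →+ A →+ N) (hB : ∀ a, B a a = 0) (a b : A) :
    extSqLift B hB (extSq A a b) = B a b :=
  exteriorPower.alternatingMapLinearEquiv_apply_ιMulti _ ![a, b]

lemma closure_range_extSq :
    AddSubgroup.closure {x : ⋀[ℤ]^2 A | ∃ a b, extSq A a b = x} = ⊤ := by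
  rw [eq_top_iff]
  intro x _
  have hx : x ∈ Submodule.span ℤ (Set.range (exteriorPower.ιMulti ℤ 2 (M := A))) := by
    exact (exteriorPower.ιMulti_span ℤ 2 A).symm ▸ Submodule.mem_top
  induction hx using Submodule.span_induction with
  | mem y hy =>
    obtain ⟨v, rfl⟩ := hy
    refine AddSubgroup.subset_closure ⟨v 0, v 1, ?_⟩
    rw [extSq_apply]
    congr 1
    ext i
    fin_cases i <;> rfl
  | zero => exact zero_mem _
  | add y z _ _ hy hz => exact add_mem (hy trivial) (hz trivial)
  | smul c y _ hy =>
    rw [show c • y = _ from int_smul_eq_zsmul inferInstance c y]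
    exact zsmul_mem (hy trivial) c

lemma extSq_hom_ext {f g : ⋀[ℤ]^2 A →+ N}
    (h : ∀ a b, f (extSq A a b) = g (extSq A a b)) : f = g :=
  AddMonoidHom.eq_of_eqOn_dense closure_range_extSq (by rintro _ ⟨a, b, rfl⟩; exact h a b)

/-- If the exterior product of two vectors of a rational vector space vanishes over `ℤ`,
then the vectors are linearly dependent over `ℚ`. -/
lemma not_linearIndependent_of_extSq_eq_zero [Module ℚ A] {a b : A} (h : extSq A a b = 0) :
    ¬ LinearIndependent ℚ ![a, b] := by
  intro hli
  obtain ⟨g, hg⟩ := (Finsupp.linearCombination ℚ ![a, b]).exists_leftInverse_of_injective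
    (LinearMap.ker_eq_bot.mpr hli)
  have hga : g a = Finsupp.single 0 1 := by
    simpa using LinearMap.congr_fun hg (Finsupp.single 0 1)
  have hgb : g b = Finsupp.single 1 1 := by
    simpa using LinearMap.congr_fun hg (Finsupp.single 1 1)
  let B : A →+ A →+ ℚ := AddMonoidHom.mk' (fun x => AddMonoidHom.mk'
    (fun y => g x 0 * g y 1 - g x 1 * g y 0)
    (fun y y' => by simp only [map_add, Finsupp.add_apply]; ring))
    (fun x x' => by
      ext y
      simp only [AddMonoidHom.mk'_apply, AddMonoidHom.add_apply, map_add, Finsupp.add_apply]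
      ring)
  have hB : ∀ x, B x x = 0 := fun x => by
    simp only [B, AddMonoidHom.mk'_apply]; ring
  have h1 := extSqLift_extSq B hB a b
  rw [h, map_zero] at h1
  simp [B, hga, hgb] at h1

end ExteriorSquare

section LogWedge

lemma wedge_eq_extSq (a b : ℂ) : wedge a b = extSq ℂ a b := rfl

lemma Cpi_mul_I_ne_zero : Cpi * I ≠ 0 :=
  mul_ne_zero (ofReal_ne_zero.mpr Real.pi_ne_zero) I_ne_zero

lemma exp_Cpi_mul_I : Complex.exp (Cpi * I) = -1 := Complex.exp_pi_mul_I

/-- The exponential as a homomorphism `ℂ → ℂ*`. -/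
def expHom : ℂ →+ Additive ℂˣ :=
  AddMonoidHom.mk' (fun w => Additive.ofMul (Units.mk0 (Complex.exp w) (Complex.exp_ne_zero w)))
    fun w w' => by
      rw [← ofMul_mul]
      congr 1
      ext
      simp [Complex.exp_add]

lemma expHom_apply (w : ℂ) :
    expHom w = Additive.ofMul (Units.mk0 (Complex.exp w) (Complex.exp_ne_zero w)) := rfl

lemma expHom_log (z : Additive ℂˣ) : expHom (Complex.log (z.toMul : ℂ)) = z := by
  rw [expHom_apply]
  apply Additive.toMul.injective
  ext
  simp [Complex.exp_log]

lemma eq_add_of_exp_eq {w w' : ℂ} (h : Complex.exp w = Complex.exp w') :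
    ∃ k : ℤ, w = w' + (2 * k) • (Cpi * I) := by
  obtain ⟨k, hk⟩ := Complex.exp_eq_exp_iff_exists_int.mp h
  refine ⟨k, ?_⟩
  rw [hk, zsmul_eq_mul, Cpi]
  push_cast
  ring

lemma log_mul_eq (a b : Additive ℂˣ) : ∃ k : ℤ, Complex.log ((a + b).toMul : ℂ) =
    Complex.log (a.toMul : ℂ) + Complex.log (b.toMul : ℂ) + (2 * k) • (Cpi * I) := by
  apply eq_add_of_exp_eq
  rw [Complex.exp_add, Complex.exp_log (Units.ne_zero _), Complex.exp_log (Units.ne_zero _),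
    Complex.exp_log (Units.ne_zero _)]
  simp

/-- The homomorphism `z ↦ (Log z) ∧ πi`. -/
def logWedgePi : Additive ℂˣ →+ L2C :=
  AddMonoidHom.mk' (fun z => extSq ℂ (Complex.log (z.toMul : ℂ)) (Cpi * I)) fun a b => by
    obtain ⟨k, hk⟩ := log_mul_eq a b
    rw [hk, extSq_add_left, extSq_add_left, extSq_zsmul_left, extSq_self, smul_zero, add_zero]

lemma logWedgePi_apply (z : Additive ℂˣ) :
    logWedgePi z = extSq ℂ (Complex.log (z.toMul : ℂ)) (Cpi * I) := rfl

lemma logWedgePi_expHom (w : ℂ) : logWedgePi (expHom w) = extSq ℂ w (Cpi * I) := by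
  have h : Complex.exp (Complex.log ((expHom w).toMul : ℂ)) = Complex.exp w := by
    rw [Complex.exp_log (Units.ne_zero _)]; rfl
  obtain ⟨k, hk⟩ := eq_add_of_exp_eq h
  rw [logWedgePi_apply, hk, extSq_add_left, extSq_zsmul_left, extSq_self, smul_zero, add_zero]

lemma extSq_pi_right_mem_range (w : ℂ) : extSq ℂ w (Cpi * I) ∈ logWedgePi.range :=
  ⟨expHom w, logWedgePi_expHom w⟩

lemma extSq_pi_left_mem_range (w : ℂ) : extSq ℂ (Cpi * I) w ∈ logWedgePi.range := by
  rw [extSq_swap]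
  exact neg_mem (extSq_pi_right_mem_range w)

lemma logWedgePi_eq_zero_iff (ζ : ℂˣ) : logWedgePi (Additive.ofMul ζ) = 0 ↔ ζ ∈ muStar := by
  rw [logWedgePi_apply, toMul_ofMul]
  constructor
  · intro h
    have hli := not_linearIndependent_of_extSq_eq_zero h
    rw [LinearIndependent.pair_symm_iff, LinearIndependent.pair_iff' Cpi_mul_I_ne_zero] at hli
    push Not at hli
    obtain ⟨q, hq⟩ := hli
    refine ⟨2 * q.den, by have := q.den_pos; omega, ?_⟩
    ext
    rw [Units.val_pow_eq_pow_val, Units.val_one, ← Complex.exp_log ζ.ne_zero, ← hq,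
      ← Complex.exp_nat_mul, Complex.exp_eq_one_iff]
    refine ⟨q.num, ?_⟩
    have hd : (q.den : ℂ) * (q : ℂ) = q.num := by exact_mod_cast Rat.den_mul_eq_num q
    rw [Rat.smul_def, Cpi, ← hd]
    push_cast
    ring
  · rintro ⟨n, hn, h⟩
    have hexp : Complex.exp (n * Complex.log ζ) = Complex.exp 0 := by
      rw [Complex.exp_nat_mul, Complex.exp_log ζ.ne_zero, Complex.exp_zero]
      rw [← Units.val_pow_eq_pow_val, h, Units.val_one]
    obtain ⟨k, hk⟩ := eq_add_of_exp_eq hexp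
    have hn' : (n : ℂ) ≠ 0 := by exact_mod_cast hn.ne'
    have h1 : Complex.log ζ = (2 * k) • (Cpi * I / n) := by
      rw [zero_add, zsmul_eq_mul] at hk
      rw [zsmul_eq_mul, ← mul_div_assoc, eq_div_iff hn', ← hk, mul_comm]
    have h2 : Cpi * I = n • (Cpi * I / n) := by
      rw [nsmul_eq_mul, mul_div_cancel₀ _ hn']
    rw [h1]
    nth_rw 2 [h2]
    rw [extSq_zsmul_left, map_nsmul, extSq_self, smul_zero, smul_zero]

/-- The homomorphism `w₁ ∧ w₂ ↦ -2 (e^{w₁} ∧ e^{w₂})`. -/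
def expWedge : L2C →+ L2CU :=
  (zsmulAddGroupHom (-2)).comp
    (extSqLift (((extSq (Additive ℂˣ)).compl₂ expHom).comp expHom) fun a => extSq_self (expHom a))

lemma expWedge_extSq (w₁ w₂ : ℂ) :
    expWedge (extSq ℂ w₁ w₂) = -((2 : ℤ) • extSq (Additive ℂˣ) (expHom w₁) (expHom w₂)) := by
  refine (congrArg (zsmulAddGroupHom (-2)) (extSqLift_extSq _ _ w₁ w₂)).trans ?_
  rw [zsmulAddGroupHom_apply, neg_zsmul]
  rfl

lemma mk_extSq_add_pi_left (u v : ℂ) (k : ℤ) :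
    QuotientAddGroup.mk' logWedgePi.range (extSq ℂ (u + k • (Cpi * I)) v) =
      QuotientAddGroup.mk' logWedgePi.range (extSq ℂ u v) := by
  refine QuotientAddGroup.eq_iff_sub_mem.mpr ?_
  rw [extSq_add_left, extSq_zsmul_left, add_sub_cancel_left]
  exact zsmul_mem (extSq_pi_left_mem_range v) k

lemma mk_extSq_add_pi_right (u v : ℂ) (k : ℤ) :
    QuotientAddGroup.mk' logWedgePi.range (extSq ℂ u (v + k • (Cpi * I))) =
      QuotientAddGroup.mk' logWedgePi.range (extSq ℂ u v) := by
  refine QuotientAddGroup.eq_iff_sub_mem.mpr ?_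
  rw [map_add, map_zsmul, add_sub_cancel_left]
  exact zsmul_mem (extSq_pi_right_mem_range u) k

/-- The homomorphism `a ∧ b ↦ -(Log a / 2) ∧ Log b`, well defined modulo the range of
`logWedgePi`. -/
def halfLogWedge : L2CU →+ L2C ⧸ logWedgePi.range :=
  extSqLift
    (AddMonoidHom.mk' (fun a => AddMonoidHom.mk'
      (fun b => QuotientAddGroup.mk' logWedgePi.range
        (extSq ℂ (-(Complex.log (a.toMul : ℂ) / 2)) (Complex.log (b.toMul : ℂ))))
      fun b b' => by
        obtain ⟨k, hk⟩ := log_mul_eq b b'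
        rw [hk, mk_extSq_add_pi_right, map_add, map_add])
      fun a a' => by
        ext b
        obtain ⟨k, hk⟩ := log_mul_eq a a'
        have h : -(Complex.log ((a + a').toMul : ℂ) / 2) = -(Complex.log (a.toMul : ℂ) / 2) +
            -(Complex.log (a'.toMul : ℂ) / 2) + (-k) • (Cpi * I) := by
          rw [hk, zsmul_eq_mul, zsmul_eq_mul]
          push_cast
          ring
        change QuotientAddGroup.mk' logWedgePi.range (extSq ℂ _ _) =
          QuotientAddGroup.mk' logWedgePi.range (extSq ℂ _ _) +
            QuotientAddGroup.mk' logWedgePi.range (extSq ℂ _ _)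
        rw [h, mk_extSq_add_pi_left, extSq_add_left, map_add])
    fun a => by
      have h : extSq ℂ (-(Complex.log (a.toMul : ℂ) / 2)) (Complex.log (a.toMul : ℂ)) = 0 := by
        nth_rw 2 [← add_halves (Complex.log (a.toMul : ℂ))]
        rw [map_add, extSq_neg_left, extSq_self, neg_zero, add_zero]
      exact (congrArg (QuotientAddGroup.mk' logWedgePi.range) h).trans (map_zero _)

lemma halfLogWedge_expHom (w₁ w₂ : ℂ) :
    halfLogWedge (extSq (Additive ℂˣ) (expHom w₁) (expHom w₂)) =
      QuotientAddGroup.mk' logWedgePi.range (extSq ℂ (-(w₁ / 2)) w₂) := by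
  have h (w : ℂ) : ∃ k : ℤ, Complex.log ((expHom w).toMul : ℂ) = w + (2 * k) • (Cpi * I) :=
    eq_add_of_exp_eq (by rw [Complex.exp_log (Units.ne_zero _)]; rfl)
  obtain ⟨k₁, h₁⟩ := h w₁
  obtain ⟨k₂, h₂⟩ := h w₂
  have h₁' : -(Complex.log ((expHom w₁).toMul : ℂ) / 2) = -(w₁ / 2) + (-k₁) • (Cpi * I) := by
    rw [h₁, zsmul_eq_mul, zsmul_eq_mul]
    push_cast
    ring
  refine (extSqLift_extSq _ _ _ _).trans ?_
  simp only [AddMonoidHom.mk'_apply]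
  rw [h₁', h₂, mk_extSq_add_pi_left, mk_extSq_add_pi_right]

lemma halfLogWedge_comp_expWedge :
    halfLogWedge.comp expWedge = QuotientAddGroup.mk' logWedgePi.range := by
  refine extSq_hom_ext fun w₁ w₂ => ?_
  have h : w₁ = -((2 : ℤ) • (-(w₁ / 2))) := by
    rw [zsmul_eq_mul]
    push_cast
    ring
  rw [AddMonoidHom.comp_apply, expWedge_extSq, map_neg halfLogWedge, map_zsmul halfLogWedge,
    halfLogWedge_expHom]
  conv_rhs => rw [h]
  rw [extSq_neg_left ((2 : ℤ) • -(w₁ / 2)), extSq_zsmul_left,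
    map_neg (QuotientAddGroup.mk' logWedgePi.range),
    map_zsmul (QuotientAddGroup.mk' logWedgePi.range)]

lemma range_logWedgePi_eq_ker : logWedgePi.range = expWedge.ker := by
  apply le_antisymm
  · rintro _ ⟨z, rfl⟩
    have h : (2 : ℤ) • expHom (Cpi * I) = 0 := by
      rw [expHom_apply]
      apply Additive.toMul.injective
      ext
      simp [exp_Cpi_mul_I]
    rw [AddMonoidHom.mem_ker, logWedgePi_apply, expWedge_extSq, ← map_zsmul, h, map_zero, neg_zero]
  · intro x hx
    have h := DFunLike.congr_fun halfLogWedge_comp_expWedge x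
    rw [AddMonoidHom.comp_apply, AddMonoidHom.mem_ker.mp hx, map_zero] at h
    exact (QuotientAddGroup.eq_zero_iff x).mp h.symm

lemma expWedge_surjective : Function.Surjective expWedge := by
  rw [← AddMonoidHom.range_eq_top, eq_top_iff, ← closure_range_extSq, AddSubgroup.closure_le]
  rintro _ ⟨a, b, rfl⟩
  refine ⟨extSq ℂ (-(Complex.log (a.toMul : ℂ) / 2)) (Complex.log (b.toMul : ℂ)), ?_⟩
  have h : -((2 : ℤ) • (-(Complex.log (a.toMul : ℂ) / 2))) = Complex.log (a.toMul : ℂ) := by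
    rw [zsmul_eq_mul]
    push_cast
    ring
  rw [expWedge_extSq, ← extSq_zsmul_left, ← extSq_neg_left, ← map_zsmul expHom, ← map_neg expHom,
    h, expHom_log, expHom_log]

end LogWedge

/-- the sequence `0 → ℂ*/μ* → ℂ ∧_ℤ ℂ → ℂ* ∧_ℤ ℂ* → 0` is exact, where the first
map `β` is induced by `z ↦ (Log z) ∧ πi` (independent of the branch of logarithm, with kernel
exactly `μ*`) and the second map `ε` is determined by `w₁ ∧ w₂ ↦ -2(e^{w₁} ∧ e^{w₂})`. -/
theorem stmt18 :
    ∃ (β : Additive ℂˣ →+ L2C) (ε : L2C →+ L2CU),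
      (∀ (z : ℂ) (h0 : z ≠ 0),
        β (Additive.ofMul (Units.mk0 z h0)) = wedge (Complex.log z) (Cpi * I)) ∧
      (∀ (z : ℂ) (k : ℤ),
        wedge (Complex.log z + k * (2 * Cpi * I)) (Cpi * I) =
          wedge (Complex.log z) (Cpi * I)) ∧
      (∀ w₁ w₂ : ℂ, ε (wedge w₁ w₂) =
        -((2 : ℤ) • wedgeU (Units.mk0 (Complex.exp w₁) (Complex.exp_ne_zero w₁))
            (Units.mk0 (Complex.exp w₂) (Complex.exp_ne_zero w₂)))) ∧
      (∀ ζ : ℂˣ, β (Additive.ofMul ζ) = 0 ↔ ζ ∈ muStar) ∧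
      β.range = ε.ker ∧ Function.Surjective ε := by
  refine ⟨logWedgePi, expWedge, fun z h0 => rfl, fun z k => ?_, expWedge_extSq,
    logWedgePi_eq_zero_iff, range_logWedgePi_eq_ker, expWedge_surjective⟩
  have h : (k : ℂ) * (2 * Cpi * I) = (2 * k) • (Cpi * I) := by
    rw [zsmul_eq_mul]
    push_cast
    ring
  rw [wedge_eq_extSq, wedge_eq_extSq, h, extSq_add_left, extSq_zsmul_left, extSq_self,
    smul_zero, add_zero]

end ExtendedBloch

end
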